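/- Let d ≥ 2 and let t be an integer with 1 ≤ t ≤ d−1. Let u_1, …, u_d, v_1, …, v_d ∈ ℝ[x] be nonconstant polynomials of degree at most δ, all with zero constant term. Suppose there exists a subset I ⊆ {1, …, d} with |I| = t such that u_i ≢_a v_i for every i ∈ I. Then there exists a constant c > 0 depending only on δ, d and t such that for all n ∈ ℕ and all finite sets A_1, …, A_d ⊂ ℝ with |A_i| = n for each i, |u_1(A_1) + ⋯ + u_d(A_d)| · |v_1(A_1) + ⋯ + v_d(A_d)| ≥ c · n^{3 − 1/2^t}. -/

import Mathlib

open Polynomial Pointwise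

noncomputable section

/-- `p ≡_a q` : there is a nonzero real `λ` with `p(x) = λ q(x)` for all real `x`. -/
def EquivA (p q : Polynomial ℝ) : Prop :=
  ∃ l : ℝ, l ≠ 0 ∧ ∀ x : ℝ, p.eval x = l * q.eval x

/-- Rank of a real number in a finite set. -/
def rk (X : Finset ℝ) (x : ℝ) : ℕ := (X.filter (· ≤ x)).card

lemma rk_le (X : Finset ℝ) (x : ℝ) : rk X x ≤ X.card := Finset.card_filter_le _ _

lemma rk_pos {X : Finset ℝ} {x : ℝ} (hx : x ∈ X) : 1 ≤ rk X x :=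
  Finset.card_pos.2 ⟨x, by simp [hx]⟩

lemma rk_lt {X : Finset ℝ} {x y : ℝ} (h : x < y) (hy : y ∈ X) : rk X x < rk X y := by
  apply Finset.card_lt_card
  rw [Finset.ssubset_iff_of_subset]
  · exact ⟨y, by simp [hy], by simp [h]⟩
  · intro z hz
    simp only [Finset.mem_filter] at hz ⊢
    exact ⟨hz.1, hz.2.trans h.le⟩

lemma rk_inj {X : Finset ℝ} {x y : ℝ} (hx : x ∈ X) (hy : y ∈ X) (h : rk X x = rk X y) :
    x = y := by
  rcases lt_trichotomy x y with h1 | h1 | h1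
  · have := rk_lt h1 hy; omega
  · exact h1
  · have := rk_lt h1 hx; omega

lemma bad_count (m N : ℕ) (hN : 0 < N) (p : ℕ → ℕ) (hp : ∀ i < m, p i ≤ p (i + 1))
    (hpN : p m ≤ N) :
    4 * ((Finset.range m).filter (fun i => 4 * N / m < p (i + 1) - p i)).card ≤ m := by
  rcases Nat.eq_zero_or_pos m with hm | hm
  · subst hm; simp
  set S := (Finset.range m).filter (fun i => 4 * N / m < p (i + 1) - p i) with hS
  have tel : ∀ k ≤ m, ∑ i ∈ Finset.range k, (p (i + 1) - p i) + p 0 = p k := by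
    intro k hk
    induction k with
    | zero => simp
    | succ k ih =>
      rw [Finset.sum_range_succ]
      have := ih (by omega)
      have := hp k (by omega)
      omega
  have h1 : S.card * (4 * N / m + 1) ≤ ∑ i ∈ S, (p (i + 1) - p i) := by
    rw [← smul_eq_mul]
    apply Finset.card_nsmul_le_sum
    intro i hi
    simp only [hS, Finset.mem_filter] at hi
    exact hi.2
  have h2 : ∑ i ∈ S, (p (i + 1) - p i) ≤ ∑ i ∈ Finset.range m, (p (i + 1) - p i) :=
    Finset.sum_le_sum_of_subset (Finset.filter_subset _ _)
  have h3 := tel m le_rfl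
  have h4 : S.card * (4 * N / m + 1) ≤ N := by omega
  have h5 : 4 * N ≤ (4 * N / m + 1) * m := by
    have := Nat.lt_div_mul_add (a := 4 * N) hm
    nlinarith
  have h6 : S.card * (4 * N) ≤ N * m := by
    calc S.card * (4 * N) ≤ S.card * ((4 * N / m + 1) * m) := Nat.mul_le_mul_left _ h5
      _ = S.card * (4 * N / m + 1) * m := by ring
      _ ≤ N * m := Nat.mul_le_mul_right _ h4
  have : N * (4 * S.card) ≤ N * m := by linarith
  exact Nat.le_of_mul_le_mul_left this hN

lemma comb_mono (m : ℕ) (f g : ℕ → ℝ) (B C X Y : Finset ℝ)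
    (hf : ∀ i < m, f i < f (i + 1)) (hg : ∀ i < m, g i < g (i + 1))
    (hX : ∀ i ≤ m, ∀ b ∈ B, f i + b ∈ X) (hY : ∀ i ≤ m, ∀ b ∈ C, g i + b ∈ Y)
    (inj : ∀ i < m, ∀ j < m, f (i + 1) - f i = f (j + 1) - f j →
      g (i + 1) - g i = g (j + 1) - g j → i = j) :
    B.card * C.card * m ^ 3 ≤ 32 * (X.card * Y.card) ^ 2 := by
  rcases B.eq_empty_or_nonempty with hB | ⟨b0, hb0⟩
  · simp [hB]
  rcases C.eq_empty_or_nonempty with hC | ⟨c0, hc0⟩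
  · simp [hC]
  rcases Nat.eq_zero_or_pos m with hm | hm
  · subst hm; simp
  have hXp : 0 < X.card := Finset.card_pos.2 ⟨_, hX 0 (by omega) b0 hb0⟩
  have hYp : 0 < Y.card := Finset.card_pos.2 ⟨_, hY 0 (by omega) c0 hc0⟩
  set K := 4 * X.card / m with hK
  set L := 4 * Y.card / m with hL
  let G : ℝ × ℝ → Finset ℕ := fun q => (Finset.range m).filter (fun i =>
    rk X (f (i + 1) + q.1) - rk X (f i + q.1) ≤ K ∧
    rk Y (g (i + 1) + q.2) - rk Y (g i + q.2) ≤ L)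
  have hlx : ∀ b ∈ B, ∀ i < m, rk X (f i + b) < rk X (f (i + 1) + b) := fun b hb i hi =>
    rk_lt (by linarith [hf i hi]) (hX _ (by omega) b hb)
  have hly : ∀ b ∈ C, ∀ i < m, rk Y (g i + b) < rk Y (g (i + 1) + b) := fun b hb i hi =>
    rk_lt (by linarith [hg i hi]) (hY _ (by omega) b hb)
  have hG : ∀ q ∈ B ×ˢ C, m ≤ 2 * (G q).card := by
    rintro ⟨b, c⟩ hq
    obtain ⟨hb, hc⟩ := Finset.mem_product.1 hq
    have e1 := bad_count m X.card hXp (fun i => rk X (f i + b))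
      (fun i hi => (hlx b hb i hi).le) (rk_le _ _)
    have e2 := bad_count m Y.card hYp (fun i => rk Y (g i + c))
      (fun i hi => (hly c hc i hi).le) (rk_le _ _)
    have e3 : Finset.range m ⊆ G (b, c) ∪
      ((Finset.range m).filter (fun i => K < rk X (f (i + 1) + b) - rk X (f i + b)) ∪
      (Finset.range m).filter (fun i => L < rk Y (g (i + 1) + c) - rk Y (g i + c))) := by
      intro i hi
      simp only [G, Finset.mem_union, Finset.mem_filter, hi, true_and]
      omega
    have e4 := (Finset.card_le_card e3).trans (Finset.card_union_le _ _)
    have e5 := Finset.card_union_le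
      ((Finset.range m).filter (fun i => K < rk X (f (i + 1) + b) - rk X (f i + b)))
      ((Finset.range m).filter (fun i => L < rk Y (g (i + 1) + c) - rk Y (g i + c)))
    rw [Finset.card_range] at e4
    rw [← hK] at e1
    rw [← hL] at e2
    omega
  have h1 : (B.card * C.card) * m ≤ 2 * ((B ×ˢ C).sigma G).card := by
    rw [Finset.card_sigma, Finset.mul_sum, ← Finset.card_product, ← smul_eq_mul]
    exact Finset.card_nsmul_le_sum _ _ _ hG
  have h2 : ((B ×ˢ C).sigma G).card ≤ (Finset.Icc 1 X.card ×ˢ Finset.Icc 1 K ×ˢ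
      Finset.Icc 1 Y.card ×ˢ Finset.Icc 1 L).card := by
    apply Finset.card_le_card_of_injOn (fun s =>
      (rk X (f s.2 + s.1.1), rk X (f (s.2 + 1) + s.1.1) - rk X (f s.2 + s.1.1),
       rk Y (g s.2 + s.1.2), rk Y (g (s.2 + 1) + s.1.2) - rk Y (g s.2 + s.1.2)))
    · rintro ⟨⟨b, c⟩, i⟩ hs
      simp only [Finset.coe_sigma, Set.mem_sigma_iff, Finset.mem_coe, Finset.mem_product, G,
        Finset.mem_filter, Finset.mem_range] at hs
      obtain ⟨⟨hb, hc⟩, hi, hk, hl⟩ := hs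
      have a1 := hlx b hb i hi
      have a2 := hly c hc i hi
      simp only [Finset.mem_coe, Finset.mem_product, Finset.mem_Icc]
      refine ⟨⟨rk_pos (hX i hi.le b hb), rk_le _ _⟩, ⟨by omega, hk⟩,
        ⟨rk_pos (hY i hi.le c hc), rk_le _ _⟩, ⟨by omega, hl⟩⟩
    · rintro ⟨⟨b, c⟩, i⟩ hs ⟨⟨b', c'⟩, j⟩ hs' heq
      simp only [Finset.coe_sigma, Set.mem_sigma_iff, Finset.mem_coe, Finset.mem_product, G,
        Finset.mem_filter, Finset.mem_range] at hs hs'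
      obtain ⟨⟨hb, hc⟩, hi, hk, hl⟩ := hs
      obtain ⟨⟨hb', hc'⟩, hj, hk', hl'⟩ := hs'
      simp only [Prod.mk.injEq] at heq
      obtain ⟨q1, q2, q3, q4⟩ := heq
      have a1 := hlx b hb i hi
      have a2 := hly c hc i hi
      have a1' := hlx b' hb' j hj
      have a2' := hly c' hc' j hj
      have r1 := rk_inj (hX i hi.le b hb) (hX j hj.le b' hb') q1
      have r2 := rk_inj (hX (i + 1) hi b hb) (hX (j + 1) hj b' hb') (by omega)
      have r3 := rk_inj (hY i hi.le c hc) (hY j hj.le c' hc') q3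
      have r4 := rk_inj (hY (i + 1) hi c hc) (hY (j + 1) hj c' hc') (by omega)
      have hij := inj i hi j hj (by linarith) (by linarith)
      subst hij
      have : b = b' := by linarith
      subst this
      have : c = c' := by linarith
      subst this
      rfl
  simp only [Finset.card_product, Nat.card_Icc, Nat.add_sub_cancel] at h2
  have hKm : K * m ≤ 4 * X.card := Nat.div_mul_le_self _ _
  have hLm : L * m ≤ 4 * Y.card := Nat.div_mul_le_self _ _
  calc B.card * C.card * m ^ 3 = (B.card * C.card * m) * m ^ 2 := by ring
    _ ≤ (2 * (X.card * (K * (Y.card * L)))) * m ^ 2 := by gcongr ?_ * _; exact h1.trans (Nat.mul_le_mul_left 2 h2)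
    _ = 2 * X.card * Y.card * ((K * m) * (L * m)) := by ring
    _ ≤ 2 * X.card * Y.card * ((4 * X.card) * (4 * Y.card)) := by gcongr
    _ = _ := by ring

/-- Version allowing each of the sequences to be increasing or decreasing. -/
lemma comb_gen (m : ℕ) (f g : ℕ → ℝ) (B C X Y : Finset ℝ)
    (hf : (∀ i < m, f i < f (i + 1)) ∨ (∀ i < m, f (i + 1) < f i))
    (hg : (∀ i < m, g i < g (i + 1)) ∨ (∀ i < m, g (i + 1) < g i))
    (hX : ∀ i ≤ m, ∀ b ∈ B, f i + b ∈ X) (hY : ∀ i ≤ m, ∀ b ∈ C, g i + b ∈ Y)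
    (inj : ∀ i < m, ∀ j < m, f (i + 1) - f i = f (j + 1) - f j →
      g (i + 1) - g i = g (j + 1) - g j → i = j) :
    B.card * C.card * m ^ 3 ≤ 32 * (X.card * Y.card) ^ 2 := by
  have flip : ∀ (h : ℕ → ℝ) (D Z : Finset ℝ), (∀ i ≤ m, ∀ b ∈ D, h i + b ∈ Z) →
      ∀ i ≤ m, ∀ b ∈ -D, -h i + b ∈ -Z := by
    intro h D Z H i hi b hb
    rw [Finset.mem_neg'] at hb ⊢
    have := H i hi _ hb
    rwa [show -(-h i + b) = h i + -b by ring]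
  rcases hf with hf | hf <;> rcases hg with hg | hg
  · exact comb_mono m f g B C X Y hf hg hX hY inj
  · have := comb_mono m f (fun i => -g i) B (-C) X (-Y) hf
      (fun i hi => neg_lt_neg (hg i hi)) hX (flip g C Y hY)
      (fun i hi j hj h1 h2 => inj i hi j hj h1 (by linarith))
    simpa using this
  · have := comb_mono m (fun i => -f i) g (-B) C (-X) Y
      (fun i hi => neg_lt_neg (hf i hi)) hg (flip f B X hX) hY
      (fun i hi j hj h1 h2 => inj i hi j hj (by linarith) h2)
    simpa using this
  · have := comb_mono m (fun i => -f i) (fun i => -g i) (-B) (-C) (-X) (-Y)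
      (fun i hi => neg_lt_neg (hf i hi))
      (fun i hi => neg_lt_neg (hg i hi)) (flip f B X hX) (flip g C Y hY)
      (fun i hi j hj h1 h2 => inj i hi j hj (by linarith) (by linarith))
    simpa using this

lemma wr_deg (p h : ℝ[X]) (hp : p ≠ 0) (hh : h ≠ 0)
    (H : p * derivative h = derivative p * h) : h.natDegree = p.natDegree := by
  have H2 : p * (derivative h * X) = (derivative p * X) * h := by
    rw [← mul_assoc, H]; ring
  have hc : ∀ q : ℝ[X], (derivative q * X).coeff q.natDegree = q.leadingCoeff * q.natDegree := by
    intro q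
    rcases Nat.eq_zero_or_pos q.natDegree with h0 | h0
    · simp [h0]
    · obtain ⟨k, hk⟩ := Nat.exists_eq_succ_of_ne_zero h0.ne'
      rw [leadingCoeff, hk, Nat.succ_eq_add_one, coeff_mul_X, coeff_derivative]
      push_cast; ring
  have hd : ∀ q : ℝ[X], (derivative q * X).natDegree ≤ q.natDegree := by
    intro q
    rcases Nat.eq_zero_or_pos q.natDegree with h0 | h0
    · rw [derivative_of_natDegree_zero h0]; simp
    · refine natDegree_mul_le.trans ?_
      have := natDegree_derivative_le q
      simp only [natDegree_X]; omega
  have e := congrArg (fun q => coeff q (p.natDegree + h.natDegree)) H2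
  beta_reduce at e
  rw [coeff_mul_add_eq_of_natDegree_le le_rfl (hd h),
    coeff_mul_add_eq_of_natDegree_le (hd p) le_rfl, hc, hc] at e
  have h1 : p.leadingCoeff ≠ 0 := leadingCoeff_ne_zero.2 hp
  have h2 : h.leadingCoeff ≠ 0 := leadingCoeff_ne_zero.2 hh
  rw [coeff_natDegree, coeff_natDegree] at e
  have : (h.natDegree : ℝ) = p.natDegree := by
    apply mul_left_cancel₀ (mul_ne_zero h1 h2); linarith
  exact_mod_cast this

lemma wr_ne (u v : ℝ[X]) (hu : 0 < u.natDegree) (hv : 0 < v.natDegree)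
    (hu0 : u.eval 0 = 0) (hv0 : v.eval 0 = 0) (h : ¬ EquivA u v) :
    derivative u * derivative (derivative v) - derivative (derivative u) * derivative v ≠ 0 := by
  intro H
  apply h
  set p := derivative u with hp
  set q := derivative v with hq
  have hp0 : p ≠ 0 := by
    intro h0
    have := derivative_eq_zero.1 h0
    omega
  set l := q.coeff p.natDegree / p.leadingCoeff with hl
  have hpl : p.leadingCoeff ≠ 0 := leadingCoeff_ne_zero.2 hp0
  have hz : q - C l * p = 0 := by
    by_contra hne
    have e := wr_deg p (q - C l * p) hp0 hne (by
      simp only [derivative_sub, derivative_mul, derivative_C]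
      linear_combination H)
    have e2 : (q - C l * p).leadingCoeff = 0 := by
      rw [leadingCoeff, e, coeff_sub, coeff_C_mul, coeff_natDegree, hl]
      field_simp; ring
    exact hne (leadingCoeff_eq_zero.1 e2)
  have hw : derivative (v - C l * u) = 0 := by
    simp only [derivative_sub, derivative_mul, derivative_C, zero_mul, zero_add]
    exact hz
  have hw2 := eq_C_of_natDegree_eq_zero (derivative_eq_zero.1 hw)
  have hev : ∀ x, v.eval x = l * u.eval x := by
    intro x
    have a1 := congrArg (eval x) hw2
    have a2 := congrArg (eval 0) hw2
    simp only [eval_sub, eval_mul, eval_C, hu0, hv0] at a1 a2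
    rw [← a2] at a1
    linarith
  have hl0 : l ≠ 0 := by
    intro h0
    have : v = 0 := by
      apply Polynomial.funext
      intro x
      rw [hev x, h0]; simp
    rw [this] at hv; simp at hv
  exact ⟨l⁻¹, inv_ne_zero hl0, fun x => by rw [hev x]; field_simp⟩

lemma poly_mono (u : ℝ[X]) (a b : ℝ) (hab : a ≤ b)
    (h : ∀ x ∈ Set.Ioo a b, (derivative u).eval x ≠ 0) :
    StrictMonoOn (fun x => u.eval x) (Set.Icc a b) ∨
      StrictAntiOn (fun x => u.eval x) (Set.Icc a b) := by
  apply ContinuousOn.strictMonoOn_of_injOn_Icc' hab u.continuous.continuousOn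
  have key : ∀ x ∈ Set.Icc a b, ∀ y ∈ Set.Icc a b, x < y → u.eval x ≠ u.eval y := by
    intro x hx y hy hxy he
    obtain ⟨c, hc, hc0⟩ := exists_hasDerivAt_eq_zero hxy u.continuous.continuousOn he
      (fun z _ => u.hasDerivAt z)
    exact h c ⟨hx.1.trans_lt hc.1, hc.2.trans_le hy.2⟩ hc0
  intro x hx y hy he
  rcases lt_trichotomy x y with h1 | h1 | h1
  · exact absurd he (key x hx y hy h1)
  · exact h1
  · exact absurd he.symm (key y hy x hx h1)

lemma ratio_inj (p q : ℝ[X]) (a b : ℝ)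
    (hp : ∀ x ∈ Set.Ioo a b, p.eval x ≠ 0)
    (hw : ∀ x ∈ Set.Ioo a b, (p * derivative q - derivative p * q).eval x ≠ 0)
    (x y : ℝ) (hx : x ∈ Set.Ioo a b) (hy : y ∈ Set.Ioo a b)
    (h : q.eval x / p.eval x = q.eval y / p.eval y) : x = y := by
  have key : ∀ x ∈ Set.Ioo a b, ∀ y ∈ Set.Ioo a b, x < y →
      q.eval x / p.eval x ≠ q.eval y / p.eval y := by
    intro x hx y hy hxy he
    have hin : ∀ z ∈ Set.Icc x y, z ∈ Set.Ioo a b := fun z hz =>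
      ⟨hx.1.trans_le hz.1, hz.2.trans_lt hy.2⟩
    obtain ⟨c, hc, hc0⟩ := exists_hasDerivAt_eq_zero (f := fun z => q.eval z / p.eval z) hxy
      (q.continuous.continuousOn.div p.continuous.continuousOn (fun z hz => hp z (hin z hz))) he
      (fun z hz => (q.hasDerivAt z).div (p.hasDerivAt z) (hp z (hin z ⟨hz.1.le, hz.2.le⟩)))
    have hcI := hin c ⟨hc.1.le, hc.2.le⟩
    have hpc := hp c hcI
    rw [div_eq_zero_iff] at hc0
    rcases hc0 with h0 | h0
    · apply hw c hcI
      simp only [eval_sub, eval_mul]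
      linarith
    · exact hpc (by simpa using h0)
  rcases lt_trichotomy x y with h1 | h1 | h1
  · exact absurd h (key x hx y hy h1)
  · exact h1
  · exact absurd h.symm (key y hy x hx h1)

lemma piece (u v : ℝ[X]) (m : ℕ) (s : ℕ → ℝ) (hs : ∀ i < m, s i < s (i + 1))
    (hu : ∀ x ∈ Set.Ioo (s 0) (s m), (derivative u).eval x ≠ 0)
    (hv : ∀ x ∈ Set.Ioo (s 0) (s m), (derivative v).eval x ≠ 0)
    (hw : ∀ x ∈ Set.Ioo (s 0) (s m), (derivative u * derivative (derivative v) -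
      derivative (derivative u) * derivative v).eval x ≠ 0)
    (B C X Y : Finset ℝ)
    (hX : ∀ i ≤ m, ∀ b ∈ B, u.eval (s i) + b ∈ X)
    (hY : ∀ i ≤ m, ∀ b ∈ C, v.eval (s i) + b ∈ Y) :
    B.card * C.card * m ^ 3 ≤ 32 * (X.card * Y.card) ^ 2 := by
  have mono : ∀ j ≤ m, ∀ i ≤ j, s i ≤ s j := by
    intro j
    induction j with
    | zero => intro _ i hi; rw [Nat.le_zero.1 hi]
    | succ j ih =>
      intro hj i hi
      rcases Nat.lt_or_ge i (j + 1) with h | h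
      · exact (ih (by omega) i (by omega)).trans (hs j (by omega)).le
      · rw [le_antisymm hi h]
  have hmem : ∀ i ≤ m, s i ∈ Set.Icc (s 0) (s m) := fun i hi =>
    ⟨mono i hi 0 (by omega), mono m le_rfl i hi⟩
  have step : ∀ w : ℝ[X], (∀ x ∈ Set.Ioo (s 0) (s m), (derivative w).eval x ≠ 0) →
      ((∀ i < m, w.eval (s i) < w.eval (s (i + 1))) ∨
        (∀ i < m, w.eval (s (i + 1)) < w.eval (s i))) := by
    intro w hw
    rcases poly_mono w _ _ (mono m le_rfl 0 (by omega)) hw with h | h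
    · exact Or.inl fun i hi => h (hmem i hi.le) (hmem (i + 1) hi) (hs i hi)
    · exact Or.inr fun i hi => h (hmem i hi.le) (hmem (i + 1) hi) (hs i hi)
  have hsu := step u hu
  have hsub : ∀ i < m, ∀ x ∈ Set.Ioo (s i) (s (i + 1)), x ∈ Set.Ioo (s 0) (s m) :=
    fun i hi x hx => ⟨(hmem i hi.le).1.trans_lt hx.1, hx.2.trans_le (hmem (i + 1) hi).2⟩
  refine comb_gen m (fun i => u.eval (s i)) (fun i => v.eval (s i)) B C X Y
    hsu (step v hv) hX hY ?_
  intro i hi j hj h1 h2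
  have cau : ∀ i < m, ∃ x ∈ Set.Ioo (s i) (s (i + 1)),
      (derivative v).eval x / (derivative u).eval x =
      (v.eval (s (i + 1)) - v.eval (s i)) / (u.eval (s (i + 1)) - u.eval (s i)) := by
    intro i hi
    obtain ⟨x, hx, he⟩ := exists_ratio_hasDerivAt_eq_ratio_slope (fun x => u.eval x)
      (fun x => (derivative u).eval x) (hs i hi) u.continuous.continuousOn
      (fun z _ => u.hasDerivAt z) (fun x => v.eval x) (fun x => (derivative v).eval x)
      v.continuous.continuousOn (fun z _ => v.hasDerivAt z)
    refine ⟨x, hx, ?_⟩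
    have h0 := hu x (hsub i hi x hx)
    have h1 : u.eval (s (i + 1)) - u.eval (s i) ≠ 0 := by
      rcases hsu with h | h
      · exact (sub_pos.2 (h i hi)).ne'
      · exact (sub_neg.2 (h i hi)).ne
    rw [div_eq_div_iff h0 h1]
    linarith
  obtain ⟨x, hx, ex⟩ := cau i hi
  obtain ⟨y, hy, ey⟩ := cau j hj
  have hxy : x = y := ratio_inj (derivative u) (derivative v) (s 0) (s m) hu hw x y
    (hsub i hi x hx) (hsub j hj y hy) (by rw [ex, ey]; rw [h1, h2])
  subst hxy
  rcases lt_trichotomy i j with h | h | h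
  · have := mono j hj.le (i + 1) h
    linarith [hx.2, hy.1]
  · exact h
  · have := mono i hi.le (j + 1) h
    linarith [hy.2, hx.1]

lemma full (δ : ℕ) (u v : ℝ[X]) (hu : 0 < u.natDegree) (hv : 0 < v.natDegree)
    (hud : u.natDegree ≤ δ) (hvd : v.natDegree ≤ δ)
    (hu0 : u.eval 0 = 0) (hv0 : v.eval 0 = 0) (h : ¬ EquivA u v)
    (A B C X Y : Finset ℝ)
    (hX : ∀ a ∈ A, ∀ b ∈ B, u.eval a + b ∈ X)
    (hY : ∀ a ∈ A, ∀ b ∈ C, v.eval a + b ∈ Y) :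
    B.card * C.card * A.card ^ 3 ≤ (32 * (2 * (4 * δ + 1)) ^ 3) * (X.card * Y.card) ^ 2 := by
  rcases A.eq_empty_or_nonempty with hA | ⟨a0, ha0⟩
  · simp [hA]
  set W := derivative u * derivative (derivative v) - derivative (derivative u) * derivative v
    with hW
  have hW0 : W ≠ 0 := wr_ne u v hu hv hu0 hv0 h
  have hu1 : derivative u ≠ 0 := by
    intro h0; have := derivative_eq_zero.1 h0; omega
  have hv1 : derivative v ≠ 0 := by
    intro h0; have := derivative_eq_zero.1 h0; omega
  set R := derivative u * derivative v * W with hR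
  have hR0 : R ≠ 0 := mul_ne_zero (mul_ne_zero hu1 hv1) hW0
  have d1 := natDegree_derivative_le u
  have d2 := natDegree_derivative_le v
  have d3 := natDegree_derivative_le (derivative u)
  have d4 := natDegree_derivative_le (derivative v)
  have hWd : W.natDegree ≤ 2 * δ := by
    refine (natDegree_sub_le _ _).trans (max_le ?_ ?_) <;>
    · refine natDegree_mul_le.trans ?_
      omega
  have hRd : R.natDegree ≤ 4 * δ := by
    refine natDegree_mul_le.trans ?_
    have : (derivative u * derivative v).natDegree ≤ _ := natDegree_mul_le
    omega
  set Z := R.roots.toFinset with hZ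
  have hZc : Z.card ≤ 4 * δ :=
    (Multiset.toFinset_card_le _).trans ((card_roots' R).trans hRd)
  let key : ℝ → ℕ := fun x => (Z.filter (· < x)).card
  have hkey : ∀ a ∈ A, key a ∈ Finset.range (4 * δ + 1) := by
    intro a _
    have : key a ≤ Z.card := Finset.card_filter_le _ _
    rw [Finset.mem_range]; omega
  obtain ⟨y, -, hy⟩ := Finset.exists_max_image (Finset.range (4 * δ + 1))
    (fun y => (A.filter (fun x => key x = y)).card) ⟨0, by simp⟩
  set F := A.filter (fun x => key x = y) with hF
  have hcard : A.card ≤ F.card * (4 * δ + 1) := by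
    have := Finset.card_le_mul_card_image_of_maps_to hkey F.card hy
    simpa using this
  have hnoroot : ∀ a ∈ F, ∀ b ∈ F, ∀ x ∈ Set.Ioo a b, R.eval x ≠ 0 := by
    intro a ha b hb x hx h0
    have hxZ : x ∈ Z := by
      rw [hZ, Multiset.mem_toFinset, mem_roots hR0]; exact h0
    have : key a < key b := by
      apply Finset.card_lt_card
      rw [Finset.ssubset_iff_of_subset]
      · exact ⟨x, by simp [hxZ, hx.2], by simp [hx.1.le]⟩
      · intro z hz
        simp only [Finset.mem_filter] at hz ⊢
        exact ⟨hz.1, hz.2.trans (hx.1.trans hx.2)⟩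
    rw [(Finset.mem_filter.1 ha).2, (Finset.mem_filter.1 hb).2] at this
    exact lt_irrefl _ this
  have hAp : 0 < A.card := Finset.card_pos.2 ⟨a0, ha0⟩
  have hFp : 0 < F.card := by
    by_contra h0
    have : F.card = 0 := by omega
    rw [this] at hcard; omega
  obtain ⟨m, hm⟩ := Nat.exists_eq_succ_of_ne_zero hFp.ne'
  rw [Nat.succ_eq_add_one] at hm
  rcases Nat.eq_zero_or_pos m with hm0 | hmp
  · -- small case
    have hA2 : A.card ≤ 4 * δ + 1 := by rw [hm, hm0] at hcard; omega
    have hBX : B.card ≤ X.card := Finset.card_le_card_of_injOn (fun b => u.eval a0 + b)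
      (fun b hb => hX a0 ha0 b hb) (fun b _ c _ he => by simpa using he)
    have hCY : C.card ≤ Y.card := Finset.card_le_card_of_injOn (fun b => v.eval a0 + b)
      (fun b hb => hY a0 ha0 b hb) (fun b _ c _ he => by simpa using he)
    calc B.card * C.card * A.card ^ 3 ≤ (X.card * Y.card) * (4 * δ + 1) ^ 3 := by gcongr
      _ ≤ (X.card * Y.card) ^ 2 * (32 * (2 * (4 * δ + 1)) ^ 3) := by
        gcongr
        · exact Nat.le_self_pow (by norm_num) _
        · generalize 4 * δ + 1 = k
          rw [mul_pow]
          have : 0 ≤ k ^ 3 := Nat.zero_le _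
          omega
      _ = _ := by ring
  · let s : ℕ → ℝ := fun i => F.orderEmbOfFin hm ⟨min i m, by omega⟩
    have hsF : ∀ i, s i ∈ F := fun i => F.orderEmbOfFin_mem hm _
    have hRs := hnoroot (s 0) (hsF 0) (s m) (hsF m)
    have := piece u v m s (fun i hi => by
        apply (F.orderEmbOfFin hm).strictMono
        rw [Fin.mk_lt_mk]; omega)
      (fun x hx h0 => hRs x hx (by simp [hR, h0]))
      (fun x hx h0 => hRs x hx (by simp [hR, h0]))
      (fun x hx h0 => hRs x hx (by rw [hR, eval_mul, hW, h0, mul_zero]))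
      B C X Y
      (fun i _ b hb => hX _ (Finset.mem_filter.1 (hsF i)).1 b hb)
      (fun i _ b hb => hY _ (Finset.mem_filter.1 (hsF i)).1 b hb)
    have hA2 : A.card ≤ m * (2 * (4 * δ + 1)) := by
      rw [hm] at hcard
      nlinarith
    calc B.card * C.card * A.card ^ 3 ≤ B.card * C.card * (m * (2 * (4 * δ + 1))) ^ 3 := by
          gcongr
      _ = (B.card * C.card * m ^ 3) * (2 * (4 * δ + 1)) ^ 3 := by ring
      _ ≤ (32 * (X.card * Y.card) ^ 2) * (2 * (4 * δ + 1)) ^ 3 := by gcongr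
      _ = _ := by ring

/-- The sumset over a subset of the indices. -/
def SS {d : ℕ} (A : Fin d → Finset ℝ) (S : Finset (Fin d)) (u : Fin d → ℝ[X]) : Finset ℝ :=
  (Fintype.piFinset A).image fun a => ∑ i ∈ S, (u i).eval (a i)

lemma SS_base {d δ : ℕ} (A : Fin d → Finset ℝ) (n : ℕ) (hn : 0 < n) (hA : ∀ i, (A i).card = n)
    (S : Finset (Fin d)) (hS : S.Nonempty) (u : Fin d → ℝ[X])
    (hu : ∀ i, 0 < (u i).natDegree) (hd : ∀ i, (u i).natDegree ≤ δ) :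
    n ≤ (δ + 1) * (SS A S u).card := by
  obtain ⟨j, hj⟩ := hS
  have hne : ∀ i, (A i).Nonempty := fun i => Finset.card_pos.1 (by rw [hA i]; exact hn)
  choose w hw using hne
  have h1 : (A j).card ≤ δ * ((A j).image (fun x => (u j).eval x)).card := by
    apply Finset.card_le_mul_card_image
    intro b _
    have hnz : u j - C b ≠ 0 := by
      intro h0
      have := hu j
      rw [sub_eq_zero.1 h0] at this
      simp at this
    calc _ ≤ (u j - C b).roots.toFinset.card := by
          apply Finset.card_le_card
          intro x hx
          rw [Finset.mem_filter] at hx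
          rw [Multiset.mem_toFinset, mem_roots hnz]
          simp [hx.2]
      _ ≤ (u j - C b).natDegree := (Multiset.toFinset_card_le _).trans (card_roots' _)
      _ = (u j).natDegree := natDegree_sub_C
      _ ≤ δ := hd j
  have h2 : ((A j).image (fun x => (u j).eval x)).card ≤ (SS A S u).card := by
    apply Finset.card_le_card_of_injOn (fun x => x + ∑ i ∈ S.erase j, (u i).eval (w i))
    · intro x hx
      obtain ⟨a, ha, rfl⟩ := Finset.mem_image.1 hx
      refine Finset.mem_image.2 ⟨Function.update w j a, ?_, ?_⟩
      · rw [Fintype.mem_piFinset]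
        intro i
        by_cases hij : i = j
        · subst hij; simpa using ha
        · simpa [hij] using hw i
      · rw [← Finset.add_sum_erase S _ hj]
        simp only [Function.update_self]
        congr 1
        apply Finset.sum_congr rfl
        intro i hi
        rw [Function.update_of_ne (Finset.ne_of_mem_erase hi)]
    · intro x _ y _ he
      simpa using he
  rw [hA j] at h1
  nlinarith

lemma SS_step {d : ℕ} (A : Fin d → Finset ℝ) (S : Finset (Fin d)) (u : Fin d → ℝ[X])
    (j : Fin d) (hj : j ∈ S) : ∀ a ∈ A j, ∀ b ∈ SS A (S.erase j) u,
      (u j).eval a + b ∈ SS A S u := by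
  intro a ha b hb
  obtain ⟨w, hw, rfl⟩ := Finset.mem_image.1 hb
  rw [Fintype.mem_piFinset] at hw
  refine Finset.mem_image.2 ⟨Function.update w j a, ?_, ?_⟩
  · rw [Fintype.mem_piFinset]
    intro i
    by_cases hij : i = j
    · subst hij; simpa using ha
    · simpa [hij] using hw i
  · rw [← Finset.add_sum_erase S _ hj]
    simp only [Function.update_self]
    congr 1
    apply Finset.sum_congr rfl
    intro i hi
    rw [Function.update_of_ne (Finset.ne_of_mem_erase hi)]

lemma main_ind (d δ t : ℕ) : ∃ c : ℝ, 0 < c ∧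
      ∀ u v : Fin d → Polynomial ℝ,
        (∀ i, 0 < (u i).natDegree) → (∀ i, 0 < (v i).natDegree) →
        (∀ i, (u i).natDegree ≤ δ) → (∀ i, (v i).natDegree ≤ δ) →
        (∀ i, (u i).eval 0 = 0) → (∀ i, (v i).eval 0 = 0) →
        ∀ I S : Finset (Fin d), I.card = t → I ⊆ S → I ≠ S → (∀ i ∈ I, ¬ EquivA (u i) (v i)) →
        ∀ (n : ℕ) (A : Fin d → Finset ℝ), 0 < n → (∀ i, (A i).card = n) →
          c * (n : ℝ) ^ ((3 : ℝ) - 1 / 2 ^ t) ≤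
            ((SS A S u).card : ℝ) * ((SS A S v).card : ℝ) := by
  induction t with
  | zero =>
    refine ⟨1 / ((δ : ℝ) + 1) ^ 2, by positivity, ?_⟩
    intro u v hu hv hud hvd _ _ I S hI hIS hne _ n A hn hA
    have hS : S.Nonempty := by
      rw [Finset.card_eq_zero] at hI
      subst hI
      exact Finset.nonempty_iff_ne_empty.2 hne.symm
    have h1 := SS_base A n hn hA S hS u hu hud
    have h2 := SS_base A n hn hA S hS v hv hvd
    have h1' : (n : ℝ) ≤ (δ + 1) * ((SS A S u).card : ℝ) := by exact_mod_cast h1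
    have h2' : (n : ℝ) ≤ (δ + 1) * ((SS A S v).card : ℝ) := by exact_mod_cast h2
    have e : (3 : ℝ) - 1 / 2 ^ 0 = (2 : ℕ) := by norm_num
    rw [e, Real.rpow_natCast, one_div, inv_mul_le_iff₀ (by positivity)]
    calc (n : ℝ) ^ 2 = n * n := by ring
      _ ≤ ((δ + 1) * ((SS A S u).card : ℝ)) * ((δ + 1) * ((SS A S v).card : ℝ)) := by gcongr
      _ = _ := by ring
  | succ t ih =>
    obtain ⟨c, hc, ih⟩ := ih
    set K : ℝ := 32 * (2 * (4 * (δ : ℝ) + 1)) ^ 3 with hK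
    have hKp : 0 < K := by positivity
    refine ⟨Real.sqrt (c / K), by positivity, ?_⟩
    intro u v hu hv hud hvd hu0 hv0 I S hI hIS hne hE n A hn hA
    obtain ⟨j, hj⟩ : I.Nonempty := Finset.card_pos.1 (by omega)
    have hi := ih u v hu hv hud hvd hu0 hv0 (I.erase j) (S.erase j)
      (by rw [Finset.card_erase_of_mem hj]; omega) (Finset.erase_subset_erase _ hIS)
      (by
        intro h0
        apply hne
        rw [← Finset.insert_erase hj, h0, Finset.insert_erase (hIS hj)])
      (fun i hi => hE i (Finset.mem_of_mem_erase hi)) n A hn hA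
    have hf := full δ (u j) (v j) (hu j) (hv j) (hud j) (hvd j) (hu0 j) (hv0 j) (hE j hj)
      (A j) _ _ _ _ (SS_step A S u j (hIS hj)) (SS_step A S v j (hIS hj))
    rw [hA j] at hf
    have hf' : ((SS A (S.erase j) u).card : ℝ) * ((SS A (S.erase j) v).card : ℝ) * (n : ℝ) ^ 3
        ≤ K * (((SS A S u).card : ℝ) * ((SS A S v).card : ℝ)) ^ 2 := by
      rw [hK]; exact_mod_cast hf
    have hn' : (0 : ℝ) < n := by exact_mod_cast hn
    refine (sq_le_sq₀ (by positivity) (by positivity)).1 ?_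
    rw [mul_pow, Real.sq_sqrt (by positivity)]
    have e : ((n : ℝ) ^ ((3 : ℝ) - 1 / 2 ^ (t + 1))) ^ 2 =
        (n : ℝ) ^ ((3 : ℝ) - 1 / 2 ^ t) * (n : ℝ) ^ 3 := by
      rw [← Real.rpow_natCast, ← Real.rpow_mul hn'.le, ← Real.rpow_natCast (n : ℝ) 3,
        ← Real.rpow_add hn']
      congr 1
      push_cast
      rw [pow_succ]
      field_simp
      ring
    rw [e, div_mul_eq_mul_div, div_le_iff₀ hKp]
    calc c * ((n : ℝ) ^ ((3 : ℝ) - 1 / 2 ^ t) * (n : ℝ) ^ 3)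
        = (c * (n : ℝ) ^ ((3 : ℝ) - 1 / 2 ^ t)) * (n : ℝ) ^ 3 := by ring
      _ ≤ _ := mul_le_mul_of_nonneg_right hi (by positivity)
      _ ≤ _ := hf'
      _ = _ := by ring

theorem stmt16 (d t δ : ℕ) (hd : 2 ≤ d) (ht1 : 1 ≤ t) (ht2 : t ≤ d - 1) :
    ∃ c : ℝ, 0 < c ∧
      ∀ u v : Fin d → Polynomial ℝ,
        (∀ i, 0 < (u i).natDegree) → (∀ i, 0 < (v i).natDegree) →
        (∀ i, (u i).natDegree ≤ δ) → (∀ i, (v i).natDegree ≤ δ) →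
        (∀ i, (u i).eval 0 = 0) → (∀ i, (v i).eval 0 = 0) →
        (∃ I : Finset (Fin d), I.card = t ∧ ∀ i ∈ I, ¬ EquivA (u i) (v i)) →
        ∀ (n : ℕ) (A : Fin d → Finset ℝ), (∀ i, (A i).card = n) →
          c * (n : ℝ) ^ ((3 : ℝ) - 1 / 2 ^ t) ≤
            (((Fintype.piFinset A).image fun a => ∑ i, (u i).eval (a i)).card : ℝ) *
            (((Fintype.piFinset A).image fun a => ∑ i, (v i).eval (a i)).card : ℝ) := by
  obtain ⟨c, hc, H⟩ := main_ind d δ t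
  refine ⟨c, hc, ?_⟩
  rintro u v hu hv hud hvd hu0 hv0 ⟨I, hI, hE⟩ n A hA
  rcases Nat.eq_zero_or_pos n with hn | hn
  · subst hn
    have h1 : (1 : ℝ) / 2 ^ t ≤ 1 := by
      rw [div_le_one (by positivity)]
      exact one_le_pow₀ (by norm_num)
    rw [Nat.cast_zero, Real.zero_rpow (by linarith), mul_zero]
    positivity
  · refine H u v hu hv hud hvd hu0 hv0 I Finset.univ hI (Finset.subset_univ _) ?_ hE n A hn hA
    intro h0
    rw [h0, Finset.card_univ, Fintype.card_fin] at hI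
    omega
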